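/- arXiv:2404.19455 — 5 statements merged into one kernel-verified Lean document; each statement's English description precedes it below -/
import Mathlib

section
/- C¹-smallness of a single bump of the perturbation function ψ (core of Lemma 2.1): For every ε > 0 there exists δ > 0 such that for all real numbers r₁ < r₂ with r₂ − r₁ < δ and every real number c with |c| ≤ (r₂ − r₁)⁵, the function G : ℝ → ℝ given by G(x) = c·H(x), where H(x) = 0 for x ≤ r₁, H(x) = 1/(1 + exp(1/(x − r₁) + 1/(x − r₂))) for r₁ < x < r₂, and H(x) = 1 for x ≥ r₂, satisfies |G(x)| + |G'(x)| < ε for every x ∈ ℝ. -/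
/-- The `C^∞` cutoff function `h*(·, r₁, r₂)` of Section 2. -/
noncomputable def Hcut (r₁ r₂ x : ℝ) : ℝ :=
  if x ≤ r₁ then 0
  else if x < r₂ then 1 / (1 + Real.exp (1 / (x - r₁) + 1 / (x - r₂)))
  else 1

lemma Hcut_of_le {r₁ r₂ x : ℝ} (h : x ≤ r₁) : Hcut r₁ r₂ x = 0 := if_pos h

lemma Hcut_of_ge {r₁ r₂ x : ℝ} (hr : r₁ < r₂) (h : r₂ ≤ x) : Hcut r₁ r₂ x = 1 := by
  rw [Hcut, if_neg (by linarith), if_neg (by linarith)]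

lemma Hcut_of_mem {r₁ r₂ x : ℝ} (h : x ∈ Set.Ioo r₁ r₂) :
    Hcut r₁ r₂ x = 1 / (1 + Real.exp (1 / (x - r₁) + 1 / (x - r₂))) := by
  rw [Hcut, if_neg h.1.not_ge, if_pos h.2]

lemma abs_Hcut_le_one (r₁ r₂ x : ℝ) : |Hcut r₁ r₂ x| ≤ 1 := by
  unfold Hcut
  split_ifs
  · simp
  · have h := Real.exp_pos (1 / (x - r₁) + 1 / (x - r₂))
    rw [abs_of_pos (by positivity), div_le_one (by positivity)]
    linarith
  · simp

/-- If a function is constant on a set `s` with unique derivatives at `x ∈ s`, then its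
derivative at `x` is zero, whether or not it is differentiable there. -/
lemma deriv_eq_zero_of_eqOn_const {f : ℝ → ℝ} {s : Set ℝ} {x a : ℝ}
    (hs : UniqueDiffWithinAt ℝ s x) (hx : x ∈ s) (hf : ∀ y ∈ s, f y = a) : deriv f x = 0 := by
  by_cases hd : DifferentiableAt ℝ f x
  · exact hs.eq_deriv s hd.hasDerivAt.hasDerivWithinAt
      ((hasDerivWithinAt_const x s a).congr hf (hf x hx))
  · exact deriv_zero_of_not_differentiableAt hd

lemma hasDerivAt_Hcut {r₁ r₂ x : ℝ} (h : x ∈ Set.Ioo r₁ r₂) :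
    HasDerivAt (Hcut r₁ r₂)
      (Real.exp (1 / (x - r₁) + 1 / (x - r₂)) * ((1 / (x - r₁)) ^ 2 + (1 / (x - r₂)) ^ 2) /
        (1 + Real.exp (1 / (x - r₁) + 1 / (x - r₂))) ^ 2) x := by
  have h₁ : x - r₁ ≠ 0 := sub_ne_zero.mpr h.1.ne'
  have h₂ : x - r₂ ≠ 0 := sub_ne_zero.mpr h.2.ne
  have hE := Real.exp_pos (1 / (x - r₁) + 1 / (x - r₂))
  have hd := ((((((hasDerivAt_id x).sub_const r₁).fun_inv h₁).fun_add
    (((hasDerivAt_id x).sub_const r₂).fun_inv h₂)).exp).const_add 1).fun_inv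
      (by simp only [id, ← one_div]; positivity)
  simp only [id, ← one_div] at hd
  refine (hd.congr_of_eventuallyEq ?_).congr_deriv ?_
  · filter_upwards [isOpen_Ioo.mem_nhds h] with y hy using Hcut_of_mem hy
  · field_simp
    ring

lemma exp_mul_sq_le (η : ℝ) : Real.exp η * η ^ 2 ≤ 2 * (1 + Real.exp η) ^ 2 := by
  have hE := Real.exp_pos η
  rcases le_total 0 η with h | h
  · have := Real.quadratic_le_exp_of_nonneg h
    nlinarith
  · have h₁ := Real.quadratic_le_exp_of_nonneg (neg_nonneg.mpr h)
    have h₂ : Real.exp η * Real.exp (-η) = 1 := by rw [← Real.exp_add]; simp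
    nlinarith

lemma sq_mul_inv_sq_add_le {s t : ℝ} (hs : 0 < s) (ht : 0 < t) :
    (s + t) ^ 2 * ((1 / s) ^ 2 + (1 / t) ^ 2) ≤ 3 * (s + t) ^ 2 * (1 / s - 1 / t) ^ 2 + 10 := by
  wlog h : s ≤ t generalizing s t
  · have := this ht hs (le_of_not_ge h)
    nlinarith
  have hb : 1 / t * (s + t) ≤ 2 := by
    rw [div_mul_eq_mul_div, div_le_iff₀ ht]; linarith
  have hb₀ : 0 < 1 / t * (s + t) := by positivity
  have hd : 0 ≤ (1 / s - 1 / t) * (s + t) :=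
    mul_nonneg (sub_nonneg.mpr (one_div_le_one_div_of_le hs h)) (by positivity)
  generalize 1 / s = u at *
  generalize 1 / t = v at *
  generalize s + t = w at *
  have key : ∀ d b : ℝ, 0 ≤ d → 0 < b → b ≤ 2 → (d + b) ^ 2 + b ^ 2 ≤ 3 * d ^ 2 + 10 := by
    intro d b hd hb₀ hb
    nlinarith [sq_nonneg (d - 1), mul_nonneg hd (sub_nonneg.mpr hb)]
  have := key _ _ hd hb₀ hb
  nlinarith

lemma sq_mul_abs_deriv_Hcut_le {r₁ r₂ : ℝ} (hr : r₁ < r₂) (x : ℝ) :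
    (r₂ - r₁) ^ 2 * |deriv (Hcut r₁ r₂) x| ≤ 6 * (r₂ - r₁) ^ 2 + 10 := by
  have hout : deriv (Hcut r₁ r₂) x = 0 →
      (r₂ - r₁) ^ 2 * |deriv (Hcut r₁ r₂) x| ≤ 6 * (r₂ - r₁) ^ 2 + 10 := by
    intro h
    rw [h, abs_zero, mul_zero]
    positivity
  rcases le_or_gt x r₁ with h₁ | h₁
  · exact hout (deriv_eq_zero_of_eqOn_const (uniqueDiffOn_Iic x x Set.self_mem_Iic)
      Set.self_mem_Iic fun y hy => Hcut_of_le (le_trans hy h₁))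
  rcases le_or_gt r₂ x with h₂ | h₂
  · exact hout (deriv_eq_zero_of_eqOn_const (uniqueDiffOn_Ici x x Set.self_mem_Ici)
      Set.self_mem_Ici fun y hy => Hcut_of_ge hr (le_trans h₂ hy))
  rw [(hasDerivAt_Hcut ⟨h₁, h₂⟩).deriv, abs_of_nonneg (by positivity), ← mul_div_assoc,
    div_le_iff₀ (by positivity)]
  have hq := sq_mul_inv_sq_add_le (sub_pos.mpr h₁) (sub_pos.mpr h₂)
  have hneg : 1 / (r₂ - x) = -(1 / (x - r₂)) := by rw [← neg_sub x r₂, one_div_neg_eq_neg_one_div]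
  rw [hneg, sub_neg_eq_add, neg_sq, show x - r₁ + (r₂ - x) = r₂ - r₁ by ring] at hq
  have he := exp_mul_sq_le (1 / (x - r₁) + 1 / (x - r₂))
  have hE := Real.exp_pos (1 / (x - r₁) + 1 / (x - r₂))
  generalize Real.exp (1 / (x - r₁) + 1 / (x - r₂)) = E at *
  calc (r₂ - r₁) ^ 2 * (E * ((1 / (x - r₁)) ^ 2 + (1 / (x - r₂)) ^ 2))
      = E * ((r₂ - r₁) ^ 2 * ((1 / (x - r₁)) ^ 2 + (1 / (x - r₂)) ^ 2)) := by ring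
    _ ≤ E * (3 * (r₂ - r₁) ^ 2 * (1 / (x - r₁) + 1 / (x - r₂)) ^ 2 + 10) := by gcongr
    _ = 3 * (r₂ - r₁) ^ 2 * (E * (1 / (x - r₁) + 1 / (x - r₂)) ^ 2) + 10 * E := by ring
    _ ≤ 3 * (r₂ - r₁) ^ 2 * (2 * (1 + E) ^ 2) + 10 * (1 + E) ^ 2 := by
        gcongr
        nlinarith
    _ = (6 * (r₂ - r₁) ^ 2 + 10) * (1 + E) ^ 2 := by ring

/-- C¹-smallness of a single bump of the perturbation function ψ (core of Lemma 2.1):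
for every `ε > 0` there is `δ > 0` such that any bump `G = c · H(·, r₁, r₂)` of width
`r₂ - r₁ < δ` and amplitude `|c| ≤ (r₂ - r₁)⁵` satisfies `|G(x)| + |G'(x)| < ε` for all `x`. -/
theorem bump_C1_small :
    ∀ ε > (0 : ℝ), ∃ δ > (0 : ℝ), ∀ r₁ r₂ : ℝ, r₁ < r₂ → r₂ - r₁ < δ →
      ∀ c : ℝ, |c| ≤ (r₂ - r₁) ^ 5 →
        ∀ x : ℝ,
          |c * Hcut r₁ r₂ x| + |deriv (fun y => c * Hcut r₁ r₂ y) x| < ε := by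
  intro ε hε
  refine ⟨min 1 (ε / 17), by positivity, fun r₁ r₂ hr hδ c hc x => ?_⟩
  have hH := abs_Hcut_le_one r₁ r₂ x
  have hD := sq_mul_abs_deriv_Hcut_le hr x
  have hw₁ : r₂ - r₁ ≤ 1 := (hδ.trans_le (min_le_left _ _)).le
  have hwε : r₂ - r₁ < ε / 17 := hδ.trans_le (min_le_right _ _)
  have hw : 0 < r₂ - r₁ := sub_pos.mpr hr
  rw [deriv_const_mul_field, abs_mul, abs_mul]
  generalize r₂ - r₁ = w at *
  have hpow : ∀ n : ℕ, n ≠ 0 → w ^ n ≤ w := fun n hn => pow_le_of_le_one hw.le hw₁ hn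
  calc |c| * |Hcut r₁ r₂ x| + |c| * |deriv (Hcut r₁ r₂) x|
      ≤ w ^ 5 * 1 + w ^ 5 * |deriv (Hcut r₁ r₂) x| := by gcongr
    _ = w ^ 5 + w ^ 3 * (w ^ 2 * |deriv (Hcut r₁ r₂) x|) := by ring
    _ ≤ w ^ 5 + w ^ 3 * (6 * w ^ 2 + 10) := by gcongr
    _ = 7 * w ^ 5 + 10 * w ^ 3 := by ring
    _ ≤ 7 * w + 10 * w := by gcongr <;> exact hpow _ (by norm_num)
    _ < ε := by linarith
end

section
/- Negativity estimate (3.5) for the solutions Θₙ of the lower Cauchy problems: Let m ≥ 1 and n ≥ 0 be integers and M₁ > 0, K > 0 real numbers, and let R : ℝ × ℝ → ℝ satisfy |R(x,y)| ≤ K for all (x,y). Then there exists δ₀ > 0 such that for every δ ∈ (0, δ₀) and every differentiable function y : ℝ → ℝ satisfying y(−M₁δ) = −δᵐ(1 + nδ) and y'(x) = R(x, y(x)) · ∏_{i=1}^{m} (x − (i−1)δ) for all x ∈ [−M₁δ, (m−1)δ], one has |y(x) + δᵐ| ≤ (n + K(M₁ + m − 1)^{m+1}) δ^{m+1} and y(x)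 < 0 for all x ∈ [−M₁δ, (m−1)δ]. -/
/-- On `[-aδ, (m-1)δ]` the polynomial with roots `0, δ, …, (m-1)δ` is at most
`((a + m - 1)δ)ᵐ` in absolute value. -/
theorem abs_prod_sub_mul_le (m : ℕ) {a δ x : ℝ} (ha : 0 ≤ a) (hδ : 0 ≤ δ)
    (hx : x ∈ Set.Icc (-a * δ) (((m : ℝ) - 1) * δ)) :
    |∏ i ∈ Finset.range m, (x - (i : ℝ) * δ)| ≤ ((a + (m : ℝ) - 1) * δ) ^ m := by
  rw [Finset.abs_prod]
  refine (Finset.prod_le_prod (fun _ _ => abs_nonneg _) fun i hi => ?_).trans_eq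
    (Finset.prod_const ((a + (m : ℝ) - 1) * δ) |>.trans (by rw [Finset.card_range]))
  have him : (i : ℝ) + 1 ≤ m := by exact_mod_cast Finset.mem_range.mp hi
  have hi_nonneg : 0 ≤ (i : ℝ) * δ := by positivity
  have hi_le : ((i : ℝ) + 1) * δ ≤ m * δ := mul_le_mul_of_nonneg_right him hδ
  have haδ : 0 ≤ a * δ := by positivity
  rw [abs_le]
  constructor <;> linarith [hx.1, hx.2]

/-- Negativity estimate (3.5) for the solutions `Θₙ` of the lower Cauchy problems:
with roots at `(i-1)δ`, `i = 1, …, m`, and initial value `y(-M₁δ) = -δᵐ(1 + nδ)`,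
for all small `δ > 0` any solution of
`y' = R(x, y)·∏_{i=1}^{m}(x - (i-1)δ)` on `[-M₁δ, (m-1)δ]` satisfies
`|y(x) + δᵐ| ≤ (n + K(M₁ + m - 1)^{m+1})δ^{m+1}` and `y(x) < 0` on that interval. -/
theorem theta_estimate
    (m : ℕ) (hm : 1 ≤ m) (n : ℕ) (M₁ K : ℝ) (hM₁ : 0 < M₁) (hK : 0 < K)
    (R : ℝ × ℝ → ℝ) (hR : ∀ p : ℝ × ℝ, |R p| ≤ K) :
    ∃ δ₀ > (0 : ℝ), ∀ δ ∈ Set.Ioo (0 : ℝ) δ₀, ∀ y : ℝ → ℝ,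
      Differentiable ℝ y →
      y (-M₁ * δ) = -δ ^ m * (1 + (n : ℝ) * δ) →
      (∀ x ∈ Set.Icc (-M₁ * δ) (((m : ℝ) - 1) * δ),
        deriv y x = R (x, y x) * ∏ i ∈ Finset.range m, (x - (i : ℝ) * δ)) →
      ∀ x ∈ Set.Icc (-M₁ * δ) (((m : ℝ) - 1) * δ),
        |y x + δ ^ m| ≤ ((n : ℝ) + K * (M₁ + (m : ℝ) - 1) ^ (m + 1)) * δ ^ (m + 1) ∧
        y x < 0 := by
  have hL : 0 ≤ M₁ + (m : ℝ) - 1 := by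
    have : (1 : ℝ) ≤ m := by exact_mod_cast hm
    linarith
  set L := M₁ + (m : ℝ) - 1 with hLdef
  have hC : 0 ≤ (n : ℝ) + K * L ^ (m + 1) := by positivity
  set C := (n : ℝ) + K * L ^ (m + 1) with hCdef
  refine ⟨1 / (C + 1), by positivity, ?_⟩
  rintro δ ⟨hδ, hδC⟩ y hy hinit hderiv x hx
  have hbound : ∀ t ∈ Set.Icc (-M₁ * δ) (((m : ℝ) - 1) * δ),
      ‖deriv y t‖ ≤ K * (L * δ) ^ m := fun t ht => by
    rw [hderiv t ht, norm_mul]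
    exact mul_le_mul (hR _) (abs_prod_sub_mul_le m hM₁.le hδ.le ht) (abs_nonneg _) hK.le
  have hleft : -M₁ * δ ∈ Set.Icc (-M₁ * δ) (((m : ℝ) - 1) * δ) :=
    Set.left_mem_Icc.mpr (hx.1.trans hx.2)
  have hincr := (convex_Icc _ _).norm_image_sub_le_of_norm_deriv_le
    (fun t _ => hy t) hbound hleft hx
  have hlen : ‖x - -M₁ * δ‖ ≤ L * δ := by
    rw [Real.norm_of_nonneg (by linarith [hx.1])]
    linarith [hx.2]
  have hdrift : |y x - y (-M₁ * δ)| ≤ K * L ^ (m + 1) * δ ^ (m + 1) :=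
    calc |y x - y (-M₁ * δ)| ≤ K * (L * δ) ^ m * (L * δ) :=
          hincr.trans (mul_le_mul_of_nonneg_left hlen (by positivity))
      _ = K * L ^ (m + 1) * δ ^ (m + 1) := by rw [mul_pow, pow_succ L, pow_succ δ]; ring
  have hest : |y x + δ ^ m| ≤ C * δ ^ (m + 1) := by
    have hsplit : y x + δ ^ m = (y x - y (-M₁ * δ)) + -((n : ℝ) * δ ^ (m + 1)) := by
      rw [hinit]
      ring
    have hn : |-((n : ℝ) * δ ^ (m + 1))| = n * δ ^ (m + 1) := by
      rw [abs_neg, abs_of_nonneg (by positivity)]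
    rw [hsplit, hCdef, add_mul]
    linarith [abs_add_le (y x - y (-M₁ * δ)) (-((n : ℝ) * δ ^ (m + 1)))]
  refine ⟨hest, ?_⟩
  have hCδ : C * δ < 1 := by
    have := (lt_div_iff₀ (by positivity)).mp hδC
    linarith
  have hlt : C * δ ^ (m + 1) < δ ^ m := by
    calc C * δ ^ (m + 1) = C * δ * δ ^ m := by ring
      _ < δ ^ m := mul_lt_of_lt_one_left (by positivity) hCδ
  linarith [(abs_le.mp hest).2]
end

section
/- Limit relation (3.9)–(3.10) for the implicitly defined return abscissa: Let R : ℝ → ℝ be continuous with R(0) ≠ 0, let r₁ > 0, r₂ > 0, δ₀ > 0 and c be real numbers, and let p : ℝ → ℝ be a function such that p(δ)/δ → c as δ → 0⁺ and such that for every δ ∈ (0, δ₀) one has ∫_{−r₂δ}^{p(δ)} R(s)(s + r₁δ)(s + δ) s ds = 0. Then 3c⁴ + 4(1 + r₁)c³ + 6r₁c² = 3r₂⁴ − 4(1 + r₁)r₂³ + 6r₁r₂²; equivalently, c²·h(−c) = r₂²·h(r₂), where h(s) = 3s² − 4(1 + r₁)s + 6r₁. -/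
open Filter

/-- Rescaling the integration variable by `δ` turns the cubic weight into `δ ^ 4` times its
normalised form. -/
theorem integral_mul_cubic_rescale (R : ℝ → ℝ) (r δ a b : ℝ) :
    ∫ s in (δ * a)..(δ * b), R s * (s + r * δ) * (s + δ) * s =
      δ ^ 4 * ∫ u in a..b, R (δ * u) * ((u + r) * (u + 1) * u) := by
  rw [← intervalIntegral.smul_integral_comp_mul_left, smul_eq_mul, pow_succ', mul_assoc,
    ← intervalIntegral.integral_const_mul (δ ^ 3)]
  congr 2
  ext u
  ring

theorem integral_normalised_cubic (r a b : ℝ) :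
    ∫ u in a..b, (u + r) * (u + 1) * u =
      (3 * b ^ 4 + 4 * (1 + r) * b ^ 3 + 6 * r * b ^ 2) / 12 -
        (3 * a ^ 4 + 4 * (1 + r) * a ^ 3 + 6 * r * a ^ 2) / 12 := by
  refine intervalIntegral.integral_eq_sub_of_hasDerivAt
    (f := fun u => (3 * u ^ 4 + 4 * (1 + r) * u ^ 3 + 6 * r * u ^ 2) / 12) (fun u _ => ?_)
    (Continuous.intervalIntegrable (by fun_prop) _ _)
  have h := ((((hasDerivAt_pow 4 u).const_mul 3).add
    ((hasDerivAt_pow 3 u).const_mul (4 * (1 + r)))).add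
    ((hasDerivAt_pow 2 u).const_mul (6 * r))).div_const 12
  refine h.congr_deriv ?_
  norm_num
  ring

/-- Limit relation (3.9)–(3.10) for the implicitly defined return abscissa:
if `R` is continuous with `R(0) ≠ 0`, `p(δ)/δ → c` as `δ → 0⁺`, and
`∫_{-r₂δ}^{p(δ)} R(s)(s + r₁δ)(s + δ)s ds = 0` for all `δ ∈ (0, δ₀)`, then
`3c⁴ + 4(1 + r₁)c³ + 6r₁c² = 3r₂⁴ − 4(1 + r₁)r₂³ + 6r₁r₂²`. -/
theorem return_abscissa_limit_relation
    (R : ℝ → ℝ) (hRcont : Continuous R) (hR0 : R 0 ≠ 0)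
    (r₁ r₂ δ₀ c : ℝ) (hr₁ : 0 < r₁) (hr₂ : 0 < r₂) (hδ₀ : 0 < δ₀)
    (p : ℝ → ℝ)
    (hlim : Tendsto (fun δ => p δ / δ) (nhdsWithin 0 (Set.Ioi 0)) (nhds c))
    (hint : ∀ δ ∈ Set.Ioo (0 : ℝ) δ₀,
      ∫ s in (-r₂ * δ)..(p δ), R s * (s + r₁ * δ) * (s + δ) * s = 0) :
    3 * c ^ 4 + 4 * (1 + r₁) * c ^ 3 + 6 * r₁ * c ^ 2 =
      3 * r₂ ^ 4 - 4 * (1 + r₁) * r₂ ^ 3 + 6 * r₁ * r₂ ^ 2 := by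
  have hcont : Continuous fun x : ℝ × ℝ =>
      ∫ u in (-r₂)..x.2, R (x.1 * u) * ((u + r₁) * (u + 1) * u) :=
    intervalIntegral.continuous_parametric_intervalIntegral_of_continuous
      (f := fun (x : ℝ × ℝ) u => R (x.1 * u) * ((u + r₁) * (u + 1) * u))
      (by unfold Function.uncurry; fun_prop) continuous_snd
  have hid : Tendsto (fun δ : ℝ => δ) (nhdsWithin 0 (Set.Ioi 0)) (nhds 0) :=
    tendsto_id.mono_left nhdsWithin_le_nhds
  have htends := (hcont.tendsto (0, c)).comp (hid.prodMk_nhds hlim)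
  have hzero : ∀ᶠ δ in nhdsWithin (0 : ℝ) (Set.Ioi 0),
      ∫ u in (-r₂)..(p δ / δ), R (δ * u) * ((u + r₁) * (u + 1) * u) = 0 := by
    filter_upwards [Ioo_mem_nhdsGT hδ₀] with δ hδ
    have hδ0 : δ ≠ 0 := hδ.1.ne'
    have h := integral_mul_cubic_rescale R r₁ δ (-r₂) (p δ / δ)
    rw [mul_div_cancel₀ _ hδ0, mul_comm δ (-r₂), hint δ hδ] at h
    exact (mul_eq_zero.mp h.symm).resolve_left (pow_ne_zero 4 hδ0)
  have hval : ∫ u in (-r₂)..c, R (0 * u) * ((u + r₁) * (u + 1) * u) = 0 :=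
    tendsto_nhds_unique htends (tendsto_const_nhds.congr' (hzero.mono fun _ h => h.symm))
  simp only [zero_mul] at hval
  rw [intervalIntegral.integral_const_mul, integral_normalised_cubic] at hval
  linear_combination 12 * (mul_eq_zero.mp hval).resolve_left hR0
end

section
/- Limit of the slope function at infinity: Let r₁ be a real number and h(s) = 3s² − 4(1 + r₁)s + 6r₁. Let r₀ > 0 and let κ : ℝ → ℝ be any function satisfying κ(r)²·h(κ(r)·r) = h(r) for all r ≥ r₀. Then |κ(r)| → 1 as r → +∞. -/
open Filter

/-- A quantitative bound: a solution `k` of the slope relation at `r ≥ 1` has `|k|` within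
`O(1 / r)` of `1`. -/
lemma abs_abs_sub_one_le_of_slope_relation {A B k r : ℝ} (hr : 1 ≤ r)
    (hk : k ^ 2 * (3 * (k * r) ^ 2 - A * (k * r) + B) = 3 * r ^ 2 - A * r + B) :
    |(|k| - 1)| ≤ (|A| + |B|) / r := by
  have hr0 : 0 < r := by linarith
  set t := |k| with ht
  have ht0 : 0 ≤ t := abs_nonneg k
  have hk2 : k ^ 2 = t ^ 2 := (sq_abs k).symm
  set P := (t + 1) * (t ^ 2 + 1) with hP
  have hP0 : 0 < P := by positivity
  have key : 3 * ((t - 1) * P) * r ^ 2 = A * (k ^ 3 - 1) * r - B * (k ^ 2 - 1) := by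
    have h4 : t ^ 4 = k ^ 4 := by
      rw [show t ^ 4 = (t ^ 2) ^ 2 by ring, ← hk2]; ring
    have hfac : (t - 1) * P = k ^ 4 - 1 := by rw [← h4, hP]; ring
    rw [hfac]
    linear_combination hk
  have hcube : |k ^ 3 - 1| ≤ P := by
    calc |k ^ 3 - 1| ≤ |k ^ 3| + |1| := abs_sub _ _
      _ = t ^ 3 + 1 := by rw [abs_pow, abs_one]
      _ ≤ P := by rw [hP]; nlinarith [sq_nonneg t]
  have hsq : |k ^ 2 - 1| ≤ P := by
    calc |k ^ 2 - 1| ≤ |k ^ 2| + |1| := abs_sub _ _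
      _ = t ^ 2 + 1 := by rw [abs_pow, abs_one]
      _ ≤ P := by rw [hP]; nlinarith [mul_nonneg ht0 (sq_nonneg t)]
  have hbound : 3 * (|t - 1| * P) * r ^ 2 ≤ (|A| + |B|) * P * r := by
    calc 3 * (|t - 1| * P) * r ^ 2 = |3 * ((t - 1) * P) * r ^ 2| := by
          simp only [abs_mul, abs_of_pos hP0, abs_pow, abs_of_pos hr0, Nat.abs_ofNat]
      _ ≤ |A * (k ^ 3 - 1) * r| + |B * (k ^ 2 - 1)| := by rw [key]; exact abs_sub _ _
      _ = |A| * |k ^ 3 - 1| * r + |B| * |k ^ 2 - 1| := by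
          simp only [abs_mul, abs_of_pos hr0]
      _ ≤ |A| * P * r + |B| * P * r := by
          have hB : |B| * |k ^ 2 - 1| ≤ |B| * P := by gcongr
          have hBr : |B| * P ≤ |B| * P * r := le_mul_of_one_le_right (by positivity) hr
          have hA : |A| * |k ^ 3 - 1| * r ≤ |A| * P * r := by gcongr
          linarith
      _ = (|A| + |B|) * P * r := by ring
  rw [le_div_iff₀ hr0]
  refine le_of_mul_le_mul_right (a := P * r) ?_ (by positivity)
  have hnonneg : 0 ≤ |t - 1| * P * r ^ 2 := by positivity
  linarith

/-- Limit of the slope function at infinity: if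
`κ(r)²·h(κ(r)·r) = h(r)` for all `r ≥ r₀ > 0`, where `h(s) = 3s² − 4(1 + r₁)s + 6r₁`,
then `|κ(r)| → 1` as `r → +∞`. -/
theorem slope_limit_at_infinity (r₁ : ℝ)
    (h : ℝ → ℝ) (hh : ∀ s : ℝ, h s = 3 * s ^ 2 - 4 * (1 + r₁) * s + 6 * r₁)
    (r₀ : ℝ) (hr₀ : 0 < r₀) (κ : ℝ → ℝ)
    (hκ : ∀ r : ℝ, r₀ ≤ r → (κ r) ^ 2 * h (κ r * r) = h r) :
    Tendsto (fun r => |κ r|) atTop (nhds 1) := by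
  rw [tendsto_iff_norm_sub_tendsto_zero]
  refine squeeze_zero' (Eventually.of_forall fun r => norm_nonneg _) ?_
    (tendsto_const_nhds.div_atTop tendsto_id :
      Tendsto (fun r : ℝ => (|4 * (1 + r₁)| + |6 * r₁|) / r) atTop (nhds 0))
  filter_upwards [eventually_ge_atTop r₀, eventually_ge_atTop 1] with r hr hr1
  have hrel := hκ r hr
  rw [hh, hh] at hrel
  exact abs_abs_sub_one_le_of_slope_relation hr1 hrel
end

section
/- Limit of the slope function at zero: Let r₁ ≠ 0 be a real number and h(s) = 3s² − 4(1 + r₁)s + 6r₁. Let r₀ > 0, M > 0, and let κ : ℝ → ℝ be a function satisfying |κ(r)| ≤ M and κ(r)²·h(κ(r)·r) = h(r) for all r ∈ (0, r₀). Then |κ(r)| → 1 as r → 0⁺. -/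
open Filter

/-- Limit of the slope function at zero: if `r₁ ≠ 0`, `|κ(r)| ≤ M`, and
`κ(r)²·h(κ(r)·r) = h(r)` for all `r ∈ (0, r₀)`, where `h(s) = 3s² − 4(1 + r₁)s + 6r₁`,
then `|κ(r)| → 1` as `r → 0⁺`. -/
theorem slope_limit_at_zero (r₁ : ℝ) (hr₁ : r₁ ≠ 0)
    (h : ℝ → ℝ) (hh : ∀ s : ℝ, h s = 3 * s ^ 2 - 4 * (1 + r₁) * s + 6 * r₁)
    (r₀ M : ℝ) (hr₀ : 0 < r₀) (hM : 0 < M) (κ : ℝ → ℝ)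
    (hbound : ∀ r ∈ Set.Ioo (0 : ℝ) r₀, |κ r| ≤ M)
    (hκ : ∀ r ∈ Set.Ioo (0 : ℝ) r₀, (κ r) ^ 2 * h (κ r * r) = h r) :
    Tendsto (fun r => |κ r|) (nhdsWithin 0 (Set.Ioi 0)) (nhds 1) := by
  have hcont : Tendsto h (nhds 0) (nhds (6 * r₁)) := by
    have hc : Continuous h := by
      rw [funext hh]
      fun_prop
    simpa [hh 0] using hc.tendsto 0
  have hmem : ∀ᶠ r in nhdsWithin (0 : ℝ) (Set.Ioi 0), r ∈ Set.Ioo (0 : ℝ) r₀ :=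
    Ioo_mem_nhdsGT hr₀
  have hid : Tendsto (fun r : ℝ => r) (nhdsWithin 0 (Set.Ioi 0)) (nhds 0) :=
    tendsto_id.mono_left nhdsWithin_le_nhds
  have hprod : Tendsto (fun r => κ r * r) (nhdsWithin 0 (Set.Ioi 0)) (nhds 0) := by
    refine squeeze_zero_norm' (a := fun r => M * |r|) ?_ ?_
    · filter_upwards [hmem] with r hr
      rw [Real.norm_eq_abs, abs_mul]
      exact mul_le_mul_of_nonneg_right (hbound r hr) (abs_nonneg r)
    · simpa using hid.abs.const_mul M
  have hne : 6 * r₁ ≠ 0 := mul_ne_zero (by norm_num) hr₁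
  have hden := hcont.comp hprod
  have hsq : Tendsto (fun r => κ r ^ 2) (nhdsWithin 0 (Set.Ioi 0)) (nhds 1) := by
    have hquot := (hcont.comp hid).div hden hne
    rw [div_self hne] at hquot
    refine hquot.congr' ?_
    filter_upwards [hmem, hden.eventually_ne hne] with r hr hr'
    exact (eq_div_of_mul_eq hr' (hκ r hr)).symm
  simpa [Real.sqrt_sq_eq_abs] using hsq.sqrt
end
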